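/- Let a be a real number with 0 < a ≤ √2 and let J_a be the associated Jacobi operator on ℓ²(ℕ, ℂ). Then the operator norm of J_a equals 2, the spectrum of J_a is the closed interval [−2, 2], J_a has no eigenvalues, and the standard basis vector δ₀ is cyclic for J_a. -/

import Mathlib

noncomputable section

/-- The coordinates of `J ξ` are those given by the Jacobi matrix with off-diagonal entries
`a, 1, 1, …` and zero diagonal. -/
structure IsJacobi (a : ℝ) (J : lp (fun _ : ℕ => ℂ) 2 →L[ℂ] lp (fun _ : ℕ => ℂ) 2) : Prop where
  apply_zero : ∀ ξ, J ξ 0 = (a : ℂ) * ξ 1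
  apply_one : ∀ ξ, J ξ 1 = (a : ℂ) * ξ 0 + ξ 2
  apply_add_two : ∀ ξ n, J ξ (n + 2) = ξ (n + 1) + ξ (n + 3)

theorem hasSum_norm_sq_lp (x : lp (fun _ : ℕ => ℂ) 2) :
    HasSum (fun n => ‖x n‖ ^ 2) (‖x‖ ^ 2) := by
  have h := lp.hasSum_norm (p := 2) (by norm_num) x
  simpa using h

theorem tendsto_lp_apply_zero (x : lp (fun _ : ℕ => ℂ) 2) :
    Filter.Tendsto (fun n => x n) Filter.atTop (nhds 0) := by
  have h := (hasSum_norm_sq_lp x).summable.tendsto_atTop_zero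
  rw [tendsto_zero_iff_norm_tendsto_zero]
  simpa [Real.sqrt_sq (norm_nonneg _)] using h.sqrt

/-- A solution of `x (n + 2) = l x (n + 1) - x n`, `l ∈ [-2, 2]`, that tends to `0` is `0`. -/
theorem eq_zero_of_recurrence_of_tendsto_zero {l : ℝ} (hl : l ∈ Set.Icc (-2 : ℝ) 2) {x : ℕ → ℂ}
    (hx : ∀ n, x (n + 2) = l * x (n + 1) - x n)
    (h0 : Filter.Tendsto x Filter.atTop (nhds 0)) (n : ℕ) : x n = 0 := by
  set Q : ℕ → ℝ := fun n =>
    Complex.normSq (x (n + 1) - (l / 2 : ℝ) * x n) + (1 - l ^ 2 / 4) * Complex.normSq (x n) with hQ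
  have hstep : ∀ n, Q (n + 1) = Q n := by
    intro n
    simp only [hQ, hx n, Complex.normSq_apply, Complex.sub_re, Complex.sub_im, Complex.mul_re,
      Complex.mul_im, Complex.ofReal_re, Complex.ofReal_im]
    ring
  have hconst : ∀ n, Q n = Q 0 := fun n => by
    induction n with
    | zero => rfl
    | succ k ih => rw [hstep, ih]
  have hlim : Filter.Tendsto Q Filter.atTop (nhds 0) := by
    have h1 : Filter.Tendsto (fun n => x (n + 1)) Filter.atTop (nhds 0) :=
      h0.comp (Filter.tendsto_add_atTop_nat 1)
    have h2 := (Complex.continuous_normSq.tendsto _).comp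
      (h1.sub (h0.const_mul ((l / 2 : ℝ) : ℂ)))
    have h3 := ((Complex.continuous_normSq.tendsto _).comp h0).const_mul (1 - l ^ 2 / 4)
    simpa [hQ, Function.comp_def] using h2.add h3
  have hzero : ∀ n, Q n = 0 := by
    have : Q 0 = 0 :=
      tendsto_nhds_unique (tendsto_const_nhds.congr fun n => (hconst n).symm) hlim
    exact fun n => (hconst n).trans this
  have hl4 : 0 ≤ 1 - l ^ 2 / 4 := by nlinarith [hl.1, hl.2]
  have hparts : ∀ n, Complex.normSq (x (n + 1) - (l / 2 : ℝ) * x n) = 0 ∧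
      (1 - l ^ 2 / 4) * Complex.normSq (x n) = 0 := fun n =>
    (add_eq_zero_iff_of_nonneg (Complex.normSq_nonneg _)
      (mul_nonneg hl4 (Complex.normSq_nonneg _))).1 (hzero n)
  by_cases h : 1 - l ^ 2 / 4 = 0
  · have hs : ∀ n, Complex.normSq (x (n + 1)) = Complex.normSq (x n) := by
      intro n
      rw [sub_eq_zero.1 (Complex.normSq_eq_zero.1 (hparts n).1), Complex.normSq_mul,
        Complex.normSq_ofReal]
      linear_combination -h * Complex.normSq (x n)
    have hk : ∀ k, Complex.normSq (x (k + n)) = Complex.normSq (x n) := fun k => by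
      induction k with
      | zero => simp
      | succ k ih => rw [add_right_comm, hs, ih]
    have ht := (Complex.continuous_normSq.tendsto _).comp
      (h0.comp (Filter.tendsto_add_atTop_nat n))
    have : Complex.normSq (x n) = Complex.normSq 0 :=
      tendsto_nhds_unique (by simp [Function.comp_def, hk]) ht
    simpa using this
  · exact Complex.normSq_eq_zero.1 ((mul_eq_zero.1 (hparts n).2).resolve_left h)

namespace IsJacobi

variable {a : ℝ} {J : lp (fun _ : ℕ => ℂ) 2 →L[ℂ] lp (fun _ : ℕ => ℂ) 2}

theorem norm_le_two (hJ : IsJacobi a J) (ha : a ^ 2 ≤ 2) : ‖J‖ ≤ 2 := by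
  refine J.opNorm_le_bound (by norm_num) fun x => ?_
  have key : ∀ u v : ℂ, ‖u + v‖ ^ 2 ≤ 2 * ‖u‖ ^ 2 + 2 * ‖v‖ ^ 2 := fun u v => by
    nlinarith [norm_add_le u v, sq_nonneg (‖u‖ - ‖v‖), norm_nonneg (u + v)]
  have hx := hasSum_norm_sq_lp x
  have h1 := (hasSum_nat_add_iff' 1).2 hx
  have h3 := (hasSum_nat_add_iff' 3).2 hx
  have hy := (hasSum_nat_add_iff' 2).2 (hasSum_norm_sq_lp (J x))
  have hle := hasSum_le (fun n => by rw [hJ.apply_add_two]; exact key _ _) hy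
    ((h1.mul_left 2).add (h3.mul_left 2))
  simp only [Finset.sum_range_succ, Finset.sum_range_zero, hJ.apply_zero, hJ.apply_one,
    norm_mul, Complex.norm_real, Real.norm_eq_abs, mul_pow, sq_abs] at hle
  have hk := key ((a : ℂ) * x 0) (x 2)
  simp only [norm_mul, Complex.norm_real, Real.norm_eq_abs, mul_pow, sq_abs] at hk
  refine le_of_sq_le_sq ?_ (by positivity)
  have e0 := mul_le_mul_of_nonneg_right ha (sq_nonneg ‖x 0‖)
  have e1 := mul_le_mul_of_nonneg_right ha (sq_nonneg ‖x 1‖)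
  nlinarith

theorem apply_single_zero (hJ : IsJacobi a J) :
    J (lp.single 2 0 (1 : ℂ)) = (a : ℂ) • lp.single 2 1 (1 : ℂ) := by
  ext n
  match n with
  | 0 => simp [-Complex.coe_smul, hJ.apply_zero]
  | 1 => simp [-Complex.coe_smul, hJ.apply_one]
  | n + 2 => simp [-Complex.coe_smul, hJ.apply_add_two]

theorem apply_single_one (hJ : IsJacobi a J) :
    J (lp.single 2 1 (1 : ℂ)) = (a : ℂ) • lp.single 2 0 (1 : ℂ) + lp.single 2 2 (1 : ℂ) := by
  ext n
  rw [lp.coeFn_add, Pi.add_apply, lp.coeFn_smul, Pi.smul_apply]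
  match n with
  | 0 => simp [hJ.apply_zero]
  | 1 => simp [hJ.apply_one]
  | n + 2 => simp [hJ.apply_add_two, Pi.single_apply]

theorem apply_single_add_two (hJ : IsJacobi a J) (m : ℕ) :
    J (lp.single 2 (m + 2) (1 : ℂ)) = lp.single 2 (m + 1) (1 : ℂ) + lp.single 2 (m + 3) (1 : ℂ) := by
  ext n
  match n with
  | 0 => simp [hJ.apply_zero]
  | 1 => simp [hJ.apply_one, Pi.single_apply, eq_comm]
  | n + 2 =>
    simp only [hJ.apply_add_two, lp.coeFn_add, Pi.add_apply, lp.single_apply, Pi.single_apply]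
    rw [add_comm]
    congr 2 <;> simp

theorem isSelfAdjoint (hJ : IsJacobi a J) : IsSelfAdjoint J := by
  rw [ContinuousLinearMap.isSelfAdjoint_iff']
  ext x m
  have h : ∀ y : lp (fun _ : ℕ => ℂ) 2, y m = inner ℂ (lp.single 2 m (1 : ℂ)) y := fun y => by
    simp [lp.inner_single_left]
  rw [h, ContinuousLinearMap.adjoint_inner_right]
  match m with
  | 0 => simp [-Complex.coe_smul, hJ.apply_single_zero, hJ.apply_zero, inner_smul_left, lp.inner_single_left]
  | 1 =>
    simp [-Complex.coe_smul, hJ.apply_single_one, hJ.apply_one, inner_smul_left, inner_add_left,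
      lp.inner_single_left]
  | m + 2 =>
    simp [hJ.apply_single_add_two, hJ.apply_add_two, inner_add_left, lp.inner_single_left]

/-- If `J ξ - l ξ` is supported at `0` and `l ∈ [-2, 2]`, then `ξ = 0`. -/
theorem eq_zero_of_apply_eq (hJ : IsJacobi a J) (ha : a ≠ 0) {l : ℝ}
    (hl : l ∈ Set.Icc (-2 : ℝ) 2) {x : lp (fun _ : ℕ => ℂ) 2}
    (hx : ∀ n, J x (n + 1) = l * x (n + 1)) : x = 0 := by
  have hs : ∀ n, x (n + 1) = 0 := by
    refine eq_zero_of_recurrence_of_tendsto_zero hl (x := fun n => x (n + 1)) (fun n => ?_)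
      ((tendsto_lp_apply_zero x).comp (Filter.tendsto_add_atTop_nat 1))
    have h := hx (n + 1)
    rw [hJ.apply_add_two] at h
    linear_combination h
  have h0 := hx 0
  have h1 := hs 0
  have h2 := hs 1
  simp only [zero_add, one_add_one_eq_two] at h0 h1 h2
  rw [hJ.apply_one, h1, h2] at h0
  ext n
  match n with
  | 0 => simpa [ha] using h0
  | n + 1 => simpa using hs n

theorem mem_spectrum (hJ : IsJacobi a J) (ha : a ≠ 0) {l : ℝ}
    (hl : l ∈ Set.Icc (-2 : ℝ) 2) : (l : ℂ) ∈ spectrum ℂ J := by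
  rw [spectrum.mem_iff]
  rintro ⟨u, hu⟩
  set d : lp (fun _ : ℕ => ℂ) 2 := lp.single 2 0 (1 : ℂ) with hd
  set x := (↑u⁻¹ : lp (fun _ : ℕ => ℂ) 2 →L[ℂ] lp (fun _ : ℕ => ℂ) 2) d with hxd
  have hx : (l : ℂ) • x - J x = d := by
    have h : (↑u : lp (fun _ : ℕ => ℂ) 2 →L[ℂ] lp (fun _ : ℕ => ℂ) 2) x = d := by
      rw [hxd, ← mul_apply_eq_comp, Units.mul_inv, one_apply_eq_self]
    rwa [hu, Algebra.algebraMap_eq_smul_one] at h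
  have hx0 : x = 0 := by
    refine hJ.eq_zero_of_apply_eq ha hl fun n => ?_
    have h := congrArg (fun y : lp (fun _ : ℕ => ℂ) 2 => y (n + 1)) hx
    simp only [lp.coeFn_sub, lp.coeFn_smul, Pi.sub_apply, Pi.smul_apply, smul_eq_mul, hd,
      lp.single_apply, Pi.single_apply, Nat.add_one_ne_zero, if_false] at h
    linear_combination -h
  have h := congrArg (fun y : lp (fun _ : ℕ => ℂ) 2 => y 0) hx
  simp [hx0, hd] at h

theorem norm_eq_two (hJ : IsJacobi a J) (ha : a ≠ 0) (ha' : a ^ 2 ≤ 2) : ‖J‖ = 2 := by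
  refine le_antisymm (hJ.norm_le_two ha') ?_
  have : Nontrivial (lp (fun _ : ℕ => ℂ) 2) := by
    refine ⟨lp.single 2 0 (1 : ℂ), 0, fun h => ?_⟩
    simpa using congrArg (fun y : lp (fun _ : ℕ => ℂ) 2 => y 0) h
  simpa using spectrum.norm_le_norm_of_mem
    (hJ.mem_spectrum ha (l := 2) (Set.right_mem_Icc.2 (by norm_num)))

theorem spectrum_eq (hJ : IsJacobi a J) (ha : a ≠ 0) (ha' : a ^ 2 ≤ 2) :
    spectrum ℂ J = Complex.ofReal '' Set.Icc (-2 : ℝ) 2 := by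
  ext z
  constructor
  · intro hz
    have : Nontrivial (lp (fun _ : ℕ => ℂ) 2) := by
      by_contra h
      rw [not_nontrivial_iff_subsingleton] at h
      have : Subsingleton (lp (fun _ : ℕ => ℂ) 2 →L[ℂ] lp (fun _ : ℕ => ℂ) 2) := inferInstance
      simp [spectrum.of_subsingleton] at hz
    have hre := hJ.isSelfAdjoint.mem_spectrum_eq_re hz
    refine ⟨z.re, abs_le.1 ?_, hre.symm⟩
    exact ((Complex.abs_re_le_norm z).trans (spectrum.norm_le_norm_of_mem hz)).trans
      (hJ.norm_le_two ha')
  · rintro ⟨l, hl, rfl⟩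
    exact hJ.mem_spectrum ha hl

theorem not_exists_eigenvector (hJ : IsJacobi a J) (ha : a ≠ 0) (ha' : a ^ 2 ≤ 2) :
    ¬ ∃ (z : ℂ) (x : lp (fun _ : ℕ => ℂ) 2), x ≠ 0 ∧ J x = z • x := by
  rintro ⟨z, x, hx, hz⟩
  have hmem : z ∈ spectrum ℂ J := by
    rw [spectrum.mem_iff]
    rintro ⟨u, hu⟩
    have h0 : (↑u : lp (fun _ : ℕ => ℂ) 2 →L[ℂ] lp (fun _ : ℕ => ℂ) 2) x = 0 := by
      rw [hu, Algebra.algebraMap_eq_smul_one]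
      simp [hz]
    apply hx
    have h := congrArg
      (fun T : lp (fun _ : ℕ => ℂ) 2 →L[ℂ] lp (fun _ : ℕ => ℂ) 2 => T x) u.inv_mul
    simpa only [mul_apply_eq_comp, h0, map_zero, one_apply_eq_self] using h.symm
  rw [hJ.spectrum_eq ha ha'] at hmem
  obtain ⟨l, hl, rfl⟩ := hmem
  exact hx (hJ.eq_zero_of_apply_eq ha hl fun n => by simp [-Complex.coe_smul, hz])

theorem topologicalClosure_span_eq_top (hJ : IsJacobi a J) (ha : a ≠ 0) :
    (Submodule.span ℂ
      (Set.range fun n : ℕ => (J ^ n) (lp.single 2 0 (1 : ℂ)))).topologicalClosure = ⊤ := by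
  set M := Submodule.span ℂ (Set.range fun n : ℕ => (J ^ n) (lp.single 2 0 (1 : ℂ))) with hM
  have hinv : ∀ x ∈ M, J x ∈ M := by
    intro x hx
    have hle : M ≤ M.comap (J : lp (fun _ : ℕ => ℂ) 2 →ₗ[ℂ] lp (fun _ : ℕ => ℂ) 2) := by
      rw [hM, Submodule.span_le]
      rintro _ ⟨n, rfl⟩
      refine Submodule.subset_span ⟨n + 1, ?_⟩
      simp [pow_succ']
    exact hle hx
  have h0 : lp.single 2 0 (1 : ℂ) ∈ M := Submodule.subset_span ⟨0, by simp⟩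
  have h1 : lp.single 2 1 (1 : ℂ) ∈ M := by
    have h := hinv _ h0
    rw [hJ.apply_single_zero] at h
    exact (M.smul_mem_iff (by exact_mod_cast ha)).1 h
  have h2 : lp.single 2 2 (1 : ℂ) ∈ M := by
    have h := hinv _ h1
    rw [hJ.apply_single_one] at h
    exact (M.add_mem_iff_right (M.smul_mem _ h0)).1 h
  have hpair : ∀ n, lp.single 2 (n + 1) (1 : ℂ) ∈ M ∧ lp.single 2 (n + 2) (1 : ℂ) ∈ M := by
    intro n
    induction n with
    | zero => exact ⟨h1, h2⟩
    | succ n ih =>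
      refine ⟨ih.2, ?_⟩
      have h := hinv _ ih.2
      rw [hJ.apply_single_add_two] at h
      exact (M.add_mem_iff_right ih.1).1 h
  have hall : ∀ n, lp.single 2 n (1 : ℂ) ∈ M
    | 0 => h0
    | n + 1 => (hpair n).1
  rw [eq_top_iff]
  intro x _
  refine mem_closure_of_tendsto (lp.hasSum_single (p := 2) (by norm_num) x)
    (Filter.Eventually.of_forall fun s => M.sum_mem fun i _ => ?_)
  have : lp.single 2 i (x i) = x i • lp.single (E := fun _ : ℕ => ℂ) 2 i (1 : ℂ) := by
    rw [← lp.single_smul, smul_eq_mul, mul_one]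
  rw [this]
  exact M.smul_mem _ (hall i)

end IsJacobi

/-- For `0 < a ≤ √2`, the Jacobi operator `J_a` has norm `2`, spectrum `[-2, 2]`, no
eigenvalues, and `δ₀` is a cyclic vector for it. -/
theorem stmt_16 (a : ℝ) (ha : 0 < a) (ha' : a ≤ Real.sqrt 2)
    (J : lp (fun _ : ℕ => ℂ) 2 →L[ℂ] lp (fun _ : ℕ => ℂ) 2)
    (hJ0 : ∀ ξ : lp (fun _ : ℕ => ℂ) 2, J ξ 0 = (a : ℂ) * ξ 1)
    (hJ1 : ∀ ξ : lp (fun _ : ℕ => ℂ) 2, J ξ 1 = (a : ℂ) * ξ 0 + ξ 2)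
    (hJn : ∀ (ξ : lp (fun _ : ℕ => ℂ) 2) (n : ℕ), 2 ≤ n → J ξ n = ξ (n - 1) + ξ (n + 1)) :
    ‖J‖ = 2 ∧
    spectrum ℂ J = Complex.ofReal '' Set.Icc (-2 : ℝ) 2 ∧
    (¬ ∃ (lam : ℂ) (ξ : lp (fun _ : ℕ => ℂ) 2), ξ ≠ 0 ∧ J ξ = lam • ξ) ∧
    (Submodule.span ℂ
        (Set.range fun n : ℕ => (J ^ n) (lp.single 2 0 (1 : ℂ)))).topologicalClosure = ⊤ := by
  have hJ : IsJacobi a J := ⟨hJ0, hJ1, fun ξ n => by simpa using hJn ξ (n + 2) (by omega)⟩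
  have ha2 : a ^ 2 ≤ 2 := (Real.le_sqrt ha.le (by norm_num)).1 ha'
  exact ⟨hJ.norm_eq_two ha.ne' ha2, hJ.spectrum_eq ha.ne' ha2,
    hJ.not_exists_eigenvector ha.ne' ha2, hJ.topologicalClosure_span_eq_top ha.ne'⟩
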